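/- Let A and B be deep sets of nodes of a tree T, listed in left-to-right order as A = {a_1 ◁ a_2 ◁ ⋯ ◁ a_m} and B = {b_1 ◁ b_2 ◁ ⋯ ◁ b_n}. Then for any indices i and j: (a_i, b_j) ∈ mop(A, B) if and only if a_i ◁ b_j, and (j = 1 or b_{j-1} ⊴ a_i), and (i = m or b_j ⊴ a_{i+1}). -/

import Mathlib

namespace TreeIncl

/-- Rooted, ordered, labeled trees: a label and an ordered list of children. -/
inductive OTree (α : Type) : Type where
  | node : α → List (OTree α) → OTree α

namespace OTree

variable {α β : Type}

/-- The label of the root. -/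
def label : OTree α → α
  | node a _ => a

/-- The (ordered) children subtrees of the root. -/
def children : OTree α → List (OTree α)
  | node _ cs => cs

/-- Nodes are identified with positions: lists of child indices from the root. -/
abbrev Node : Type := List ℕ

/-- The subtree rooted at a given position, if the position is valid. -/
def sub : Node → OTree α → Option (OTree α)
  | [], t => some t
  | i :: p, t =>
    match t.children[i]? with
    | some c => sub p c
    | none => none

/-- The set `V(T)` of (positions of) nodes of a tree. -/
def Pos (t : OTree α) : Set Node := {p | sub p t ≠ none}

/-- The label of the node at position `p`. -/
def labelAt (t : OTree α) (p : Node) : Option α := (sub p t).map label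

/-- `l_T`: the number of leaves of a tree. -/
def numLeaves : OTree α → ℕ
  | node _ [] => 1
  | node a (c :: cs) => numLeaves c + numLeaves (node a cs)

/-- `n_T`: the number of nodes of a tree. -/
def numNodes : OTree α → ℕ
  | node _ [] => 1
  | node a (c :: cs) => numNodes c + numNodes (node a cs)

/-- The number of leaves of the subtree rooted at position `p` (0 if `p` is invalid). -/
def leavesAt (t : OTree α) (p : Node) : ℕ := ((sub p t).map numLeaves).getD 0

/-- `v ⪯ w` : `v` is an ancestor of `w` (positions: prefix). -/
def Anc (v w : Node) : Prop := v <+: w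

/-- `v ≺ w` : `v` is a proper ancestor of `w` (positions: strict prefix). -/
def SAnc (v w : Node) : Prop := v <+: w ∧ v ≠ w

/-- `u ◁ w` : `u` is to the left of `w`
    (equivalently: `pre(u) < pre(w)` and `post(u) < post(w)`). -/
def LeftOf (u w : Node) : Prop :=
  ∃ (q : Node) (i j : ℕ) (u' w' : Node), i < j ∧ u = q ++ i :: u' ∧ w = q ++ j :: w'

/-- `u ⊴ w` : `u ◁ w` or `u ⪯ w` or `w ≺ u`. -/
def LeftOrAbove (u w : Node) : Prop := LeftOf u w ∨ Anc u w ∨ SAnc w u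

/-- The nearest common ancestor of two positions: longest common prefix. -/
def nca : Node → Node → Node
  | [], _ => []
  | _, [] => []
  | i :: u, j :: w => if i = j then i :: nca u w else []

/-- A set of nodes is deep: no node is a proper ancestor of another node in the set. -/
def DeepSet (X : Set Node) : Prop := ∀ x ∈ X, ∀ y ∈ X, ¬ SAnc x y

/-- `Deep(X)`: the elements of `X` having no proper descendant in `X`. -/
def DeepOf (X : Set Node) : Set Node := {x | x ∈ X ∧ ¬ ∃ z ∈ X, SAnc x z}

/-- `Φ(X_1, …, X_k)`: xs is a tuple with `x_i ∈ X_i` and `x_1 ◁ x_2 ◁ ⋯ ◁ x_k`. -/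
def Phi (Xs : List (Set Node)) (xs : List Node) : Prop :=
  List.Forall₂ (fun x X => x ∈ X) xs Xs ∧ xs.Chain' LeftOf

/-- `mop(X_1, …, X_k)`: the set of minimum ordered pairs. -/
def Mop (Xs : List (Set Node)) : Set (Node × Node) :=
  {p | (∃ xs, Phi Xs xs ∧ xs.head? = some p.1 ∧ xs.getLast? = some p.2) ∧
    ¬ ∃ ys y1 yk, Phi Xs ys ∧ ys.head? = some y1 ∧ ys.getLast? = some yk ∧
      ((LeftOf p.1 y1 ∧ LeftOf y1 yk ∧ LeftOrAbove yk p.2) ∨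
       (LeftOrAbove p.1 y1 ∧ LeftOf y1 yk ∧ LeftOf yk p.2))}

/-- `MopRight(Y, X)`: for `(y₁,y₂) ∈ Y`, `(y₁,x)` is in the result iff
    `(y₂,x) ∈ mop(Y|₂, X)`. -/
def MopRight (Y : Set (Node × Node)) (X : Set Node) : Set (Node × Node) :=
  {r | ∃ y2, (r.1, y2) ∈ Y ∧ (y2, r.2) ∈ Mop [Prod.snd '' Y, X]}

/-- `MopLeft(X, Y)`: for `(y₁,y₂) ∈ Y`, `(x,y₂)` is in the result iff
    `(x,y₁) ∈ mop(X, Y|₁)`. -/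
def MopLeft (X : Set Node) (Y : Set (Node × Node)) : Set (Node × Node) :=
  {r | ∃ y1, (y1, r.2) ∈ Y ∧ (r.1, y1) ∈ Mop [X, Prod.fst '' Y]}

/-- One deletion step: delete a node of the tree, making its children children of its
parent (in its place, in order); the root may be deleted when it has exactly one
child. -/
inductive DelStep : OTree α → OTree α → Prop
  | root (a : α) (t : OTree α) : DelStep (node a [t]) t
  | splice (a b : α) (pre cs post : List (OTree α)) :
      DelStep (node a (pre ++ node b cs :: post)) (node a (pre ++ cs ++ post))
  | congr (a : α) (pre post : List (OTree α)) {t t' : OTree α} :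
      DelStep t t' → DelStep (node a (pre ++ t :: post)) (node a (pre ++ t' :: post))

/-- `P ⊑ T` : `P` can be obtained from `T` by deleting nodes of `T`. -/
def Included (P T : OTree α) : Prop := Relation.ReflTransGen (fun x y => DelStep x y) T P

/-- An embedding of `P` in `T`: an injective map of nodes preserving labels,
    proper ancestorship, and the left-of relation. -/
structure IsEmb (P T : OTree α) (f : Node → Node) : Prop where
  mem : ∀ p ∈ Pos P, f p ∈ Pos T
  inj : ∀ p ∈ Pos P, ∀ q ∈ Pos P, f p = f q → p = q
  lab : ∀ p ∈ Pos P, labelAt T (f p) = labelAt P p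
  anc : ∀ p ∈ Pos P, ∀ q ∈ Pos P, (SAnc p q ↔ SAnc (f p) (f q))
  ord : ∀ p ∈ Pos P, ∀ q ∈ Pos P, (LeftOf p q ↔ LeftOf (f p) (f q))

/-- A deep embedding: no other embedding maps the root of `P` strictly deeper. -/
def IsDeepEmb (P T : OTree α) (f : Node → Node) : Prop :=
  IsEmb P T f ∧ ¬ ∃ g, IsEmb P T g ∧ SAnc (f []) (g [])

/-- `emb(P,T)`: the set of deep occurrences of `P` in `T`. -/
def emb (P T : OTree α) : Set Node := {w | ∃ f, IsDeepEmb P T f ∧ f [] = w}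

/-- `FlAt T x a q` : `q = fl(x, a)`, the first ancestor of `x` labeled `a` in `T`. -/
def FlAt (t : OTree α) (x : Node) (a : α) (q : Node) : Prop :=
  q <+: x ∧ labelAt t q = some a ∧ ∀ r, SAnc q r → r <+: x → labelAt t r ≠ some a

/-! ### Heavy leaf path decompositions -/

/-- `hv` is a heavy leaf path decomposition of `P`: for each internal node (position)
`p`, `hv p` is the index of a child with the maximum number of descendant leaves. -/
def IsHeavyDecomp (P : OTree α) (hv : Node → ℕ) : Prop :=
  ∀ p s, sub p P = some s → s.children ≠ [] →
    ∃ c, s.children[hv p]? = some c ∧ ∀ c' ∈ s.children, numLeaves c' ≤ numLeaves c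

/-- `ldepth(v)`: the number of light edges on the path from the root to `v`. -/
def ldepth (hv : Node → ℕ) (v : Node) : ℕ :=
  (List.range v.length).countP (fun n => v.getD n 0 != hv (v.take n))

/-- The light nodes on the path from the root to `v`, ordered by increasing depth
    (the root is light; a nonroot node is light iff it is not the heavy child
    of its parent). -/
def lightPrefixes (hv : Node → ℕ) (v : Node) : List Node :=
  ((List.range (v.length + 1)).map (fun n => v.take n)).filter
    (fun q => q.getLast? != some (hv q.dropLast))

/-- The position of `heavy(parent(q))` for a nonroot position `q`. -/
def heavySibPos (hv : Node → ℕ) (q : Node) : Node :=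
  q.dropLast ++ [hv q.dropLast]

/-! ### Clusters -/

/-- Two positions are adjacent in the tree (parent/child). -/
def Adj (u v : Node) : Prop := (∃ i, v = u ++ [i]) ∨ (∃ i, u = v ++ [i])

/-- `S` is (the vertex set of) a nonempty connected subgraph of `T`. -/
def Conn (T : OTree α) (S : Set Node) : Prop :=
  S.Nonempty ∧ S ⊆ Pos T ∧
    ∀ u ∈ S, ∀ v ∈ S, ∀ w, nca u v <+: w → (w <+: u ∨ w <+: v) → w ∈ S

/-- The boundary nodes of a connected subgraph `S` of `T`: nodes of `S` adjacent to a
node of `T` outside `S`, together with the root of `T` if it lies in `S`. -/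
def Boundary (T : OTree α) (S : Set Node) : Set Node :=
  {v ∈ S | (∃ u ∈ Pos T, u ∉ S ∧ Adj v u) ∨ v = []}

/-- The edges of `T` joining two nodes of `S`. -/
def EdgesIn (T : OTree α) (S : Set Node) : Set (Node × Node) :=
  {e | e.1 ∈ S ∧ e.2 ∈ S ∧ e.2 ∈ Pos T ∧ ∃ i, e.2 = e.1 ++ [i]}

/-- A cluster of `T`: a connected subgraph with at most two boundary nodes. -/
def IsCluster (T : OTree α) (S : Set Node) : Prop :=
  Conn T S ∧ (Boundary T S).encard ≤ 2

/-- A cluster partition of `T`. -/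
structure IsClusterPartition (T : OTree α) (CS : List (Set Node)) : Prop where
  cluster : ∀ S ∈ CS, IsCluster T S
  coverV : ∀ p ∈ Pos T, ∃ S ∈ CS, p ∈ S
  coverE : ∀ e ∈ EdgesIn T (Pos T), ∃ S ∈ CS, e ∈ EdgesIn T S
  disjE : CS.Pairwise (fun S₁ S₂ => EdgesIn T S₁ ∩ EdgesIn T S₂ = ∅)
  edge : ∀ S ∈ CS, (EdgesIn T S).Nonempty

/-- Binary tree: every node has at most two children. -/
def IsBinary (t : OTree α) : Prop := ∀ p s, sub p t = some s → s.children.length ≤ 2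

/-- Relabeling of a tree. -/
def omap (f : α → β) : OTree α → OTree β
  | node a cs => node (f a) (cs.attach.map (fun c => omap f c.1))
termination_by t => sizeOf t
decreasing_by
  have := List.sizeOf_lt_of_mem c.2
  simp only [OTree.node.sizeOf_spec]
  omega


theorem not_leftOf_nil_left (w : Node) : ¬ LeftOf [] w := by
  rintro ⟨q, i, j, u', w', -, h, -⟩
  simp at h

theorem not_leftOf_nil_right (u : Node) : ¬ LeftOf u [] := by
  rintro ⟨q, i, j, u', w', -, -, h⟩
  simp at h

theorem leftOf_cons_cons (i j : ℕ) (u w : Node) :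
    LeftOf (i :: u) (j :: w) ↔ i < j ∨ (i = j ∧ LeftOf u w) := by
  constructor
  · rintro ⟨q, a, b, u', w', hab, hu, hw⟩
    cases q with
    | nil =>
      simp only [List.nil_append, List.cons.injEq] at hu hw
      exact Or.inl (by omega)
    | cons c q =>
      simp only [List.cons_append, List.cons.injEq] at hu hw
      exact Or.inr ⟨hu.1.trans hw.1.symm, q, a, b, u', w', hab, hu.2, hw.2⟩
  · rintro (h | ⟨rfl, q, a, b, u', w', hab, rfl, rfl⟩)
    · exact ⟨[], i, j, u, w, h, rfl, rfl⟩
    · exact ⟨i :: q, a, b, u', w', hab, rfl, rfl⟩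

theorem LeftOf.trans {u v w : Node} (huv : LeftOf u v) (hvw : LeftOf v w) : LeftOf u w := by
  induction u generalizing v w with
  | nil => exact absurd huv (not_leftOf_nil_left _)
  | cons i u ih =>
    cases v with
    | nil => exact absurd huv (not_leftOf_nil_right _)
    | cons j v =>
      cases w with
      | nil => exact absurd hvw (not_leftOf_nil_right _)
      | cons k w =>
        rw [leftOf_cons_cons] at *
        rcases huv with h | ⟨h, huv⟩ <;> rcases hvw with h' | ⟨h', hvw⟩
        · exact Or.inl (by omega)
        · exact Or.inl (by omega)
        · exact Or.inl (by omega)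
        · exact Or.inr ⟨h.trans h', ih huv hvw⟩

instance : IsTrans Node LeftOf := ⟨fun _ _ _ => LeftOf.trans⟩

theorem leftOrAbove_iff_not_leftOf (u w : Node) : LeftOrAbove u w ↔ ¬ LeftOf w u := by
  induction u generalizing w with
  | nil => simp [LeftOrAbove, Anc, not_leftOf_nil_right]
  | cons i u ih =>
    cases w with
    | nil => simp [LeftOrAbove, SAnc, not_leftOf_nil_left]
    | cons j w =>
      have h := ih w
      simp only [LeftOrAbove, Anc, SAnc, leftOf_cons_cons, List.cons_prefix_cons, ne_eq,
        List.cons.injEq, not_and] at h ⊢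
      rcases lt_trichotomy i j with hij | rfl | hij
      · simp [hij, hij.not_gt, hij.ne']
      · simpa using h
      · simp [hij, hij.not_gt, hij.ne, hij.ne']

theorem LeftOf.irrefl (u : Node) : ¬ LeftOf u u :=
  (leftOrAbove_iff_not_leftOf u u).1 (Or.inr (Or.inl (List.prefix_refl u)))

theorem leftOf_getElem_of_lt {l : List Node} (h : l.IsChain LeftOf) {i j : ℕ} (hij : i < j)
    (hj : j < l.length) : LeftOf l[i] l[j] :=
  List.pairwise_iff_getElem.1 (List.isChain_iff_pairwise.1 h) i j (hij.trans hj) hj hij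

theorem eq_or_leftOf_getElem_of_le {l : List Node} (h : l.IsChain LeftOf) {i j : ℕ}
    (hij : i ≤ j) (hj : j < l.length) : l[i] = l[j] ∨ LeftOf l[i] l[j] := by
  rcases hij.eq_or_lt with rfl | hij
  · exact Or.inl rfl
  · exact Or.inr (leftOf_getElem_of_lt h hij hj)

theorem lt_of_leftOf_getElem {l : List Node} (h : l.IsChain LeftOf) {i j : ℕ}
    {hi : i < l.length} {hj : j < l.length} (hij : LeftOf l[i] l[j]) : i < j := by
  by_contra hle
  rcases eq_or_leftOf_getElem_of_le h (not_lt.1 hle) hi with he | hlt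
  · exact LeftOf.irrefl _ (he ▸ hij)
  · exact LeftOf.irrefl _ (hij.trans hlt)

/-- For two sets, `Φ` consists of the pairs `[a, b]` with `a ∈ A`, `b ∈ B` and `a ◁ b`, so
membership in `mop(A, B)` only involves such pairs. -/
theorem mem_mop_pair_iff (A B : Set Node) (a b : Node) :
    (a, b) ∈ Mop [A, B] ↔ (a ∈ A ∧ b ∈ B ∧ LeftOf a b) ∧
      ∀ a' ∈ A, ∀ b' ∈ B, LeftOf a' b' →
        ¬ (LeftOf a a' ∧ ¬ LeftOf b b') ∧ ¬ (¬ LeftOf a' a ∧ LeftOf b' b) := by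
  have hPhi (xs : List Node) :
      Phi [A, B] xs ↔ ∃ x y, xs = [x, y] ∧ x ∈ A ∧ y ∈ B ∧ LeftOf x y := by
    constructor
    · rintro ⟨h, hc⟩
      obtain _ | ⟨hx, _ | ⟨hy, _ | _⟩⟩ := h
      exact ⟨_, _, rfl, hx, hy, List.isChain_pair.1 hc⟩
    · rintro ⟨x, y, rfl, hx, hy, hxy⟩
      exact ⟨.cons hx (.cons hy .nil), List.isChain_pair.2 hxy⟩
  simp only [Mop, Set.mem_ofPred_eq, hPhi, leftOrAbove_iff_not_leftOf]
  constructor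
  · rintro ⟨⟨_, ⟨x, y, rfl, hx, hy, hxy⟩, h1, h2⟩, hmin⟩
    obtain rfl : x = a := by simpa using h1
    obtain rfl : y = b := by simpa using h2
    refine ⟨⟨hx, hy, hxy⟩, fun a' ha' b' hb' hab' => ⟨fun h => ?_, fun h => ?_⟩⟩
    · exact hmin ⟨[a', b'], a', b', ⟨a', b', rfl, ha', hb', hab'⟩, rfl, rfl,
        Or.inl ⟨h.1, hab', h.2⟩⟩
    · exact hmin ⟨[a', b'], a', b', ⟨a', b', rfl, ha', hb', hab'⟩, rfl, rfl,
        Or.inr ⟨h.1, hab', h.2⟩⟩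
  · rintro ⟨⟨ha, hb, hab⟩, hmin⟩
    refine ⟨⟨[a, b], ⟨a, b, rfl, ha, hb, hab⟩, rfl, rfl⟩, ?_⟩
    rintro ⟨_, y1, yk, ⟨x, y, rfl, hx, hy, hxy⟩, h1, h2, h⟩
    obtain rfl : x = y1 := by simpa using h1
    obtain rfl : y = yk := by simpa using h2
    rcases h with ⟨h, -, h'⟩ | ⟨h, -, h'⟩
    · exact (hmin x hx y hy hxy).1 ⟨h, h'⟩
    · exact (hmin x hx y hy hxy).2 ⟨h, h'⟩

/-- Characterization of `mop(A,B)` for two deep sets listed in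
left-to-right order: `(a_i, b_j) ∈ mop(A,B)` iff `a_i ◁ b_j`, and
(`j = 1` or `b_{j-1} ⊴ a_i`), and (`i = m` or `b_j ⊴ a_{i+1}`). -/
theorem mop_pair_characterization {α : Type} (T : OTree α) (as bs : List Node)
    (hAT : ∀ x ∈ as, x ∈ Pos T) (hBT : ∀ x ∈ bs, x ∈ Pos T)
    (hAord : as.Chain' LeftOf) (hBord : bs.Chain' LeftOf)
    (hAdeep : DeepSet {x | x ∈ as}) (hBdeep : DeepSet {x | x ∈ bs})
    (i j : ℕ) (hi : i < as.length) (hj : j < bs.length) :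
    ((as.getD i [], bs.getD j []) ∈ Mop [{x | x ∈ as}, {x | x ∈ bs}] ↔
      (LeftOf (as.getD i []) (bs.getD j []) ∧
        (j = 0 ∨ LeftOrAbove (bs.getD (j - 1) []) (as.getD i [])) ∧
        (i = as.length - 1 ∨ LeftOrAbove (bs.getD j []) (as.getD (i + 1) [])))) := by
  rw [mem_mop_pair_iff]
  simp only [leftOrAbove_iff_not_leftOf, List.getD_eq_getElem _ _ hi,
    List.getD_eq_getElem _ _ hj, List.getD_eq_getElem _ _ (show j - 1 < bs.length by omega)]
  constructor
  · rintro ⟨⟨-, -, hab⟩, hmin⟩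
    refine ⟨hab, or_iff_not_imp_left.2 fun hj0 h => ?_, or_iff_not_imp_left.2 fun him => ?_⟩
    · exact (hmin as[i] (List.getElem_mem _) bs[j - 1] (List.getElem_mem _) h).2
        ⟨LeftOf.irrefl _, leftOf_getElem_of_lt hBord (by omega) hj⟩
    · have hi' : i + 1 < as.length := by omega
      rw [List.getD_eq_getElem _ _ hi']
      exact fun h => (hmin as[i + 1] (List.getElem_mem _) bs[j] (List.getElem_mem _) h).1
        ⟨leftOf_getElem_of_lt hAord (by omega) hi', LeftOf.irrefl _⟩
  · rintro ⟨hab, hprev, hnext⟩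
    refine ⟨⟨List.getElem_mem _, List.getElem_mem _, hab⟩, fun a' ha' b' hb' hab' => ?_⟩
    obtain ⟨k, hk, rfl⟩ := List.getElem_of_mem ha'
    obtain ⟨l, hl, rfl⟩ := List.getElem_of_mem hb'
    constructor
    · rintro ⟨hik, hjl⟩
      have hik := lt_of_leftOf_getElem hAord hik
      have hlj : l ≤ j := not_lt.1 fun h => hjl (leftOf_getElem_of_lt hBord h hl)
      have hn := hnext.resolve_left (by omega)
      rw [List.getD_eq_getElem _ _ (show i + 1 < as.length by omega)] at hn
      have hakbj : LeftOf as[k] bs[j] := by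
        rcases eq_or_leftOf_getElem_of_le hBord hlj hj with h | h
        · exact h ▸ hab'
        · exact hab'.trans h
      rcases eq_or_leftOf_getElem_of_le hAord (show i + 1 ≤ k from hik) hk with h | h
      · exact hn (h ▸ hakbj)
      · exact hn (h.trans hakbj)
    · rintro ⟨hki, hlj⟩
      have hlj := lt_of_leftOf_getElem hBord hlj
      have hik : i ≤ k := not_lt.1 fun h => hki (leftOf_getElem_of_lt hAord h hi)
      have hp := hprev.resolve_left (by omega)
      have haibl : LeftOf as[i] bs[l] := by
        rcases eq_or_leftOf_getElem_of_le hAord hik hk with h | h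
        · exact h ▸ hab'
        · exact h.trans hab'
      rcases eq_or_leftOf_getElem_of_le hBord (show l ≤ j - 1 by omega) (by omega) with h | h
      · exact hp (h ▸ haibl)
      · exact hp (haibl.trans h)

end OTree

end TreeIncl
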